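/- Let (L₁, ∘¹_λ, [·_λ·]¹) and (L₂, ∘²_λ, [·_λ·]²) be transposed Poisson conformal algebras, and let L = L₁ ⊗_{ℂ[∂]} L₂ be their tensor product over ℂ[∂], with ℂ[∂]-module structure ∂(a⊗b) = (∂a)⊗b = a⊗(∂b). Define on L the λ-product (a₁⊗a₂)∘_λ(b₁⊗b₂) = (a₁∘¹_λ b₁)⊗(a₂∘²_λ b₂) and the λ-bracket [(a₁⊗a₂)_λ(b₁⊗b₂)] = [a₁_λ b₁]¹⊗(a₂∘²_λ b₂) + (a₁∘¹_λ b₁)⊗[a₂_λ b₂]² (where a tensor of two L_i[λ]-valued polynomials is formed by multiplying in the λ-variable and tensoring coefficients). Then (L, ∘_λ, [·_λ·]) is a transposed Poisson conformal algebra. -/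

import Mathlib

/-!
We model a `ℂ[∂]`-module as a complex vector space `L` together with an
endomorphism `D` (the action of `∂`).  A `λ`-product (or `λ`-bracket) is a
`ℂ`-bilinear map `L → L → L[λ]`, where the polynomial `x ∘_λ y = Σₙ λⁿ • cₙ`
is encoded by its finitely supported family of coefficients `ℕ →₀ L`.
Substitution of the variable `λ` by a complex scalar, or by an operator such
as `-∂-λ`, is given by `ev`; since `ℂ` is infinite, an identity of
polynomials in (several) variables `λ, μ, γ` with coefficients in a complex
vector space holds formally if and only if it holds for all complex values
of the variables, which is how all identities are stated below.
-/

namespace ConfFormal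

variable {L : Type*} [AddCommGroup L] [Module ℂ L]

/-- Evaluation of a polynomial `p = Σₙ λⁿ • pₙ` with coefficients in `L`
(encoded as the family of its coefficients) at an endomorphism `T` of `L`
(for instance at a scalar `λ`, or at an operator such as `-∂-λ`). -/
noncomputable def ev (T : Module.End ℂ L) (p : ℕ →₀ L) : L :=
  p.sum fun n x => (T ^ n) x

/-- `app m T x y` is `x ∘_T y` : the `λ`-product `x ∘_λ y` recorded by the
`ℂ`-bilinear coefficient map `m`, with the variable `λ` substituted by the
endomorphism `T`. -/
noncomputable def app (m : L →ₗ[ℂ] L →ₗ[ℂ] (ℕ →₀ L)) (T : Module.End ℂ L) (x y : L) : L :=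
  ev T (m x y)

/-- The scalar `c` viewed as an endomorphism of `L`. -/
noncomputable def sc (c : ℂ) : Module.End ℂ L := c • (1 : Module.End ℂ L)

/-- `(L, D, m)` is a conformal algebra: conformal sesquilinearity holds. -/
structure IsConfAlg (D : Module.End ℂ L) (m : L →ₗ[ℂ] L →ₗ[ℂ] (ℕ →₀ L)) : Prop where
  sesq_left : ∀ (x y : L) (l : ℂ), app m (sc l) (D x) y = -l • app m (sc l) x y
  sesq_right : ∀ (x y : L) (l : ℂ),
    app m (sc l) x (D y) = D (app m (sc l) x y) + l • app m (sc l) x y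

/-- `(L, D, m)` is a commutative associative conformal algebra. -/
structure IsCommAssocConfAlg (D : Module.End ℂ L) (m : L →ₗ[ℂ] L →ₗ[ℂ] (ℕ →₀ L))
    extends IsConfAlg D m : Prop where
  assoc : ∀ (x y z : L) (l u : ℂ),
    app m (sc l) x (app m (sc u) y z) = app m (sc (l + u)) (app m (sc l) x y) z
  comm : ∀ (x y : L) (l : ℂ), app m (sc l) x y = app m (-(D + sc l)) y x

/-- `(L, D, br)` is a Lie conformal algebra. -/
structure IsLieConfAlg (D : Module.End ℂ L) (br : L →ₗ[ℂ] L →ₗ[ℂ] (ℕ →₀ L)) : Prop where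
  sesq_left : ∀ (x y : L) (l : ℂ), app br (sc l) (D x) y = -l • app br (sc l) x y
  skew : ∀ (x y : L) (l : ℂ), app br (sc l) x y = -app br (-(sc l + D)) y x
  jacobi : ∀ (x y z : L) (l u : ℂ),
    app br (sc l) x (app br (sc u) y z) =
      app br (sc (l + u)) (app br (sc l) x y) z + app br (sc u) y (app br (sc l) x z)

/-- `(L, D, m, br)` is a transposed Poisson conformal algebra. -/
structure IsTPCA (D : Module.End ℂ L) (m br : L →ₗ[ℂ] L →ₗ[ℂ] (ℕ →₀ L)) : Prop where
  commAssoc : IsCommAssocConfAlg D m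
  lie : IsLieConfAlg D br
  tLeibniz : ∀ (x y z : L) (l u : ℂ),
    (2 : ℂ) • app m (sc l) x (app br (sc u) y z) =
      app br (sc (l + u)) (app m (sc l) x y) z + app br (sc u) y (app m (sc l) x z)

theorem sc_apply (c : ℂ) (x : L) : sc c x = c • x := by simp [sc]

theorem sc_pow_apply (c : ℂ) (n : ℕ) (x : L) : (sc c ^ n) x = c ^ n • x := by
  simp [sc, smul_pow]

/-- Evaluation at an endomorphism, as a linear map. -/
noncomputable def evL (T : Module.End ℂ L) : (ℕ →₀ L) →ₗ[ℂ] L :=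
  Finsupp.lsum ℂ fun n => T ^ n

theorem evL_apply (T : Module.End ℂ L) (p : ℕ →₀ L) : evL T p = ev T p := by
  simp [evL, ev, Finsupp.lsum_apply]

/-- The product at an endomorphism, as a bilinear map. -/
noncomputable def appL (m : L →ₗ[ℂ] L →ₗ[ℂ] (ℕ →₀ L)) (T : Module.End ℂ L) :
    L →ₗ[ℂ] L →ₗ[ℂ] L :=
  m.compr₂ (evL T)

theorem appL_apply (m : L →ₗ[ℂ] L →ₗ[ℂ] (ℕ →₀ L)) (T : Module.End ℂ L) (x y : L) :
    appL m T x y = app m T x y := by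
  simp [appL, evL_apply, app]

theorem ev_add (T : Module.End ℂ L) (p q : ℕ →₀ L) : ev T (p + q) = ev T p + ev T q := by
  simp [← evL_apply]

theorem ev_smul (T : Module.End ℂ L) (c : ℂ) (p : ℕ →₀ L) : ev T (c • p) = c • ev T p := by
  simp [← evL_apply]

theorem ev_zero (T : Module.End ℂ L) : ev T (0 : ℕ →₀ L) = 0 := by simp [ev]

theorem ev_single (T : Module.End ℂ L) (n : ℕ) (x : L) :
    ev T (Finsupp.single n x) = (T ^ n) x := by simp [ev]

section app

variable (m : L →ₗ[ℂ] L →ₗ[ℂ] (ℕ →₀ L)) (T : Module.End ℂ L)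

theorem app_add_left (x x' y : L) : app m T (x + x') y = app m T x y + app m T x' y := by
  simp [← appL_apply]

theorem app_add_right (x y y' : L) : app m T x (y + y') = app m T x y + app m T x y' := by
  simp [← appL_apply]

theorem app_zero_left (y : L) : app m T 0 y = 0 := by simp [← appL_apply]

theorem app_zero_right (x : L) : app m T x 0 = 0 := by simp [← appL_apply]

end app

/-- A polynomial with vector coefficients is determined by its values. -/
theorem ev_sc_injective {p q : ℕ →₀ L} (h : ∀ v : ℂ, ev (sc v) p = ev (sc v) q) : p = q := by
  ext n
  rw [← sub_eq_zero, ← Module.forall_dual_apply_eq_zero_iff ℂ]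
  intro f
  have key : ∀ r : ℕ →₀ L, ∀ v : ℂ,
      f (ev (sc v) r) = (r.sum fun k x => Polynomial.monomial k (f x)).eval v := by
    intro r v
    simp [ev, Finsupp.sum, Polynomial.eval_finsetSum, sc_pow_apply, mul_comm]
  have hcoeff : ∀ r : ℕ →₀ L,
      (r.sum fun k x => Polynomial.monomial k (f x)).coeff n = f (r n) := by
    intro r
    simp only [Finsupp.sum, Polynomial.finsetSum_coeff, Polynomial.coeff_monomial,
      Finset.sum_ite_eq']
    split_ifs with h0
    · rfl
    · simp [Finsupp.notMem_support_iff.mp h0]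
  have hpoly : (p.sum fun k x => Polynomial.monomial k (f x)) =
      q.sum fun k x => Polynomial.monomial k (f x) :=
    Polynomial.funext fun v => by rw [← key, ← key, h]
  rw [map_sub, ← hcoeff, ← hcoeff, hpoly, sub_self]

/-- `SubstEq T F w` says that the function `F : ℂ → L` is polynomial, and that substituting
the endomorphism `T` for its variable yields `w`. -/
def SubstEq (T : Module.End ℂ L) (F : ℂ → L) (w : L) : Prop :=
  ∃ p : ℕ →₀ L, (∀ v, F v = ev (sc v) p) ∧ w = ev T p

namespace SubstEq

variable {T : Module.End ℂ L} {F G : ℂ → L} {w w' : L}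

theorem unique (h : SubstEq T F w) (h' : SubstEq T F w') : w = w' := by
  obtain ⟨p, hp, rfl⟩ := h
  obtain ⟨q, hq, rfl⟩ := h'
  rw [ev_sc_injective fun v => (hp v).symm.trans (hq v)]

theorem app (m : L →ₗ[ℂ] L →ₗ[ℂ] (ℕ →₀ L)) (T : Module.End ℂ L) (x y : L) :
    SubstEq T (fun v => ConfFormal.app m (sc v) x y) (ConfFormal.app m T x y) :=
  ⟨m x y, fun _ => rfl, rfl⟩

theorem const (T : Module.End ℂ L) (x : L) : SubstEq T (fun _ => x) x :=
  ⟨Finsupp.single 0 x, fun v => by simp [ev_single], by simp [ev_single]⟩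

theorem add (hF : SubstEq T F w) (hG : SubstEq T G w') :
    SubstEq T (fun v => F v + G v) (w + w') := by
  obtain ⟨p, hp, rfl⟩ := hF
  obtain ⟨q, hq, rfl⟩ := hG
  exact ⟨p + q, fun v => by simp only [ev_add, hp, hq], (ev_add _ _ _).symm⟩

theorem const_smul (c : ℂ) (hF : SubstEq T F w) : SubstEq T (fun v => c • F v) (c • w) := by
  obtain ⟨p, hp, rfl⟩ := hF
  exact ⟨c • p, fun v => by simp only [ev_smul, hp], (ev_smul _ _ _).symm⟩

theorem neg (hF : SubstEq T F w) : SubstEq T (fun v => -F v) (-w) := by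
  simpa using hF.const_smul (-1)

theorem pow_smul (n : ℕ) (hF : SubstEq T F w) :
    SubstEq T (fun v => v ^ n • F v) ((T ^ n) w) := by
  have key : ∀ (S : Module.End ℂ L) (p : ℕ →₀ L),
      ev S (p.mapDomain (n + ·)) = (S ^ n) (ev S p) := by
    intro S p
    induction p using Finsupp.induction_linear with
    | zero => simp [ev_zero]
    | add p q hp hq => rw [Finsupp.mapDomain_add, ev_add, hp, hq, ev_add, map_add]
    | single k x => rw [Finsupp.mapDomain_single, ev_single, ev_single, pow_add]; rfl
  obtain ⟨p, hp, rfl⟩ := hF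
  exact ⟨p.mapDomain (n + ·), fun v => by simp only [key, sc_pow_apply, hp], (key _ _).symm⟩

/-- Substitution in a polynomial family of linear maps applied to a polynomial. -/
theorem map {M : Type*} [AddCommGroup M] [Module ℂ M] {S : Module.End ℂ M} {E : ℂ → M} {e : M}
    (A : ℂ → M →ₗ[ℂ] L) (B : M →ₗ[ℂ] L) (hB : ∀ x, B (S x) = T (B x))
    (hA : ∀ x, SubstEq T (fun v => A v x) (B x)) (hE : SubstEq S E e) :
    SubstEq T (fun v => A v (E v)) (B e) := by
  obtain ⟨p, hp, rfl⟩ := hE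
  simp only [hp]
  clear hp
  induction p using Finsupp.induction_linear with
  | zero => simpa [ev_zero] using const T (0 : L)
  | add p q hp hq => simpa [ev_add] using hp.add hq
  | single n x =>
    have hpow : B ((S ^ n) x) = (T ^ n) (B x) := by
      induction n with
      | zero => simp
      | succ n ih => rw [pow_succ', pow_succ', Module.End.mul_apply, hB, ih]; rfl
    simpa [ev_single, sc_pow_apply, hpow] using (hA x).pow_smul n

theorem comp_linear {M : Type*} [AddCommGroup M] [Module ℂ M] {S : Module.End ℂ M} {E : ℂ → M}
    {e : M} (B : M →ₗ[ℂ] L) (hB : ∀ x, B (S x) = T (B x)) (hE : SubstEq S E e) :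
    SubstEq T (fun v => B (E v)) (B e) :=
  map (fun _ => B) B hB (fun x => const T (B x)) hE

/-- Substitution inside the variable of a polynomial. -/
theorem ev_comp {R : ℂ → Module.End ℂ L} {u : ℂ}
    (hR : ∀ x, SubstEq T (fun v => R v x) (u • x)) (p : ℕ →₀ L) :
    SubstEq T (fun v => ev (R v) p) (ev (sc u) p) := by
  induction p using Finsupp.induction_linear with
  | zero => simpa [ev_zero] using const T (0 : L)
  | add p q hp hq => simpa [ev_add] using hp.add hq
  | single n x =>
    simp only [ev_single]
    induction n with
    | zero => simpa using const T x
    | succ n ih =>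
      have := map (T := T) R (sc u) (S := T) (fun y => by simp [sc_apply])
        (fun y => by simpa [sc_apply] using hR y) ih
      simpa only [pow_succ', Module.End.mul_apply] using this

end SubstEq

/-- A linear map on which `T` acts by the scalar `u` turns `T` into `u` in evaluations. -/
theorem apply_ev_of_apply_eq_smul {T : Module.End ℂ L} {u : ℂ} (A : L →ₗ[ℂ] L)
    (hA : ∀ x, A (T x) = u • A x) (p : ℕ →₀ L) : A (ev T p) = A (ev (sc u) p) := by
  have h : ∀ S : Module.End ℂ L, (∀ x, A (S x) = sc u (A x)) →
      SubstEq (sc u) (fun v => A (ev (sc v) p)) (A (ev S p)) := fun S hS =>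
    SubstEq.comp_linear A hS ⟨p, fun _ => rfl, rfl⟩
  exact (h T fun x => by rw [hA, sc_apply]).unique (h (sc u) fun x => by simp [sc_apply])

section identities

variable {D : Module.End ℂ L} {m br : L →ₗ[ℂ] L →ₗ[ℂ] (ℕ →₀ L)}

theorem IsCommAssocConfAlg.app_app_comm (h : IsCommAssocConfAlg D m)
    (hbr : ∀ (x y : L) (l : ℂ), app br (sc l) (D x) y = -l • app br (sc l) x y)
    (x y z : L) (l u : ℂ) :
    app br (sc (l + u)) (app m (sc l) x y) z = app br (sc (l + u)) (app m (sc u) y x) z := by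
  rw [h.comm x y l]
  have := apply_ev_of_apply_eq_smul (T := -(D + sc l)) (u := u)
    ((appL br (sc (l + u))).flip z) (fun w => ?_) (m y x)
  · simpa [appL_apply, app] using this
  · have := hbr w z (l + u)
    simp only [← appL_apply] at this
    simp [this, sc_apply]
    module

theorem IsCommAssocConfAlg.left_comm (h : IsCommAssocConfAlg D m) (x y z : L) (l u : ℂ) :
    app m (sc l) x (app m (sc u) y z) = app m (sc u) y (app m (sc l) x z) := by
  rw [h.assoc, h.app_app_comm h.sesq_left, h.assoc, add_comm l u]

theorem IsLieConfAlg.sesq_right (h : IsLieConfAlg D br) (x y : L) (l : ℂ) :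
    app br (sc l) x (D y) = D (app br (sc l) x y) + l • app br (sc l) x y := by
  have key : app br (-(sc l + D)) (D y) x
      = -((-(sc l + D) : Module.End ℂ L) (app br (-(sc l + D)) y x)) := by
    refine (SubstEq.app br _ _ _).unique ?_
    have := ((SubstEq.app br (-(sc l + D)) y x).pow_smul 1).neg
    simpa [h.sesq_left] using this
  rw [h.skew, key, h.skew x y l]
  simp [sc_apply]

theorem IsTPCA.two_smul_app_bracket (h : IsTPCA D m br) (a b c : L) (l u : ℂ) :
    (2 : ℂ) • app m (sc (l + u)) (app br (sc l) a b) c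
      = app br (sc l) a (app m (sc u) b c) - app br (sc u) b (app m (sc l) a c) := by
  rw [h.commAssoc.comm _ c, h.commAssoc.comm b c, h.commAssoc.comm a c]
  refine ((SubstEq.app m (-(D + sc (l + u))) c (app br (sc l) a b)).const_smul 2).unique ?_
  simp only [h.tLeibniz]
  rw [sub_eq_neg_add]
  refine SubstEq.add ?_ ?_
  · simp only [h.lie.skew _ b]
    refine SubstEq.neg ?_
    have := SubstEq.map (T := -(D + sc (l + u))) (fun v => appL br (-(sc (v + l) + D)) b)
      (appL br (sc u) b) (fun x => ?_) (fun x => ?_) (SubstEq.app m (-(D + sc l)) c a)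
    · simpa only [appL_apply] using this
    · simp only [LinearMap.neg_apply, LinearMap.add_apply, map_neg, map_add, sc_apply, map_smul,
        appL_apply, h.lie.sesq_right]
      module
    · simp only [appL_apply]
      refine SubstEq.ev_comp (fun y => ?_) _
      have h1 := ((SubstEq.const (-(D + sc (l + u))) y).pow_smul 1).neg.add
        (SubstEq.const _ (-(l • y) - D y))
      convert h1 using 1
      · funext v
        simp [sc_apply]
        module
      · simp [sc_apply]
        module
  · have := SubstEq.comp_linear (T := -(D + sc (l + u))) (appL br (sc l) a) (fun x => ?_)
      (SubstEq.app m (-(D + sc u)) c b)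
    · simpa only [appL_apply] using this
    · simp only [LinearMap.neg_apply, LinearMap.add_apply, map_neg, map_add, sc_apply, map_smul,
        appL_apply, h.lie.sesq_right]
      module

theorem IsTPCA.app_bracket (h : IsTPCA D m br) (a b c : L) (l u : ℂ) :
    app m (sc l) a (app br (sc u) b c) = (2⁻¹ : ℂ) •
      (app br (sc (l + u)) (app m (sc l) a b) c + app br (sc u) b (app m (sc l) a c)) := by
  rw [← h.tLeibniz, smul_smul, inv_mul_cancel₀ two_ne_zero, one_smul]

theorem IsTPCA.app_bracket_swap (h : IsTPCA D m br) (a b c : L) (l u : ℂ) :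
    app m (sc u) b (app br (sc l) a c) = (2⁻¹ : ℂ) •
      (app br (sc (l + u)) (app m (sc l) a b) c + app br (sc l) a (app m (sc u) b c)) := by
  rw [h.commAssoc.app_app_comm h.lie.sesq_left, h.app_bracket, add_comm u l]

theorem IsTPCA.bracket_app (h : IsTPCA D m br) (a b c : L) (l u : ℂ) :
    app m (sc (l + u)) (app br (sc l) a b) c = (2⁻¹ : ℂ) •
      (app br (sc l) a (app m (sc u) b c) - app br (sc u) b (app m (sc l) a c)) := by
  rw [← h.two_smul_app_bracket, smul_smul, inv_mul_cancel₀ two_ne_zero, one_smul]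

end identities

section tensor

open TensorProduct

variable {L₁ : Type*} [AddCommGroup L₁] [Module (Polynomial ℂ) L₁]
  {L₂ : Type*} [AddCommGroup L₂] [Module (Polynomial ℂ) L₂]

/-- A biadditive relation may be checked on pure tensors. -/
theorem tensor_induction₂ {P : L₁ ⊗[Polynomial ℂ] L₂ → L₁ ⊗[Polynomial ℂ] L₂ → Prop}
    (zero_left : ∀ y, P 0 y) (zero_right : ∀ x, P x 0)
    (add_left : ∀ x x' y, P x y → P x' y → P (x + x') y)
    (add_right : ∀ x y y', P x y → P x y' → P x (y + y'))
    (tmul : ∀ a₁ a₂ b₁ b₂, P (a₁ ⊗ₜ a₂) (b₁ ⊗ₜ b₂)) (x y) : P x y := by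
  induction x with
  | zero => exact zero_left y
  | add x x' hx hx' => exact add_left x x' y hx hx'
  | tmul a₁ a₂ =>
    induction y with
    | zero => exact zero_right _
    | add y y' hy hy' => exact add_right _ y y' hy hy'
    | tmul b₁ b₂ => exact tmul ..

/-- A triadditive relation may be checked on pure tensors. -/
theorem tensor_induction₃
    {P : L₁ ⊗[Polynomial ℂ] L₂ → L₁ ⊗[Polynomial ℂ] L₂ → L₁ ⊗[Polynomial ℂ] L₂ → Prop}
    (zero_left : ∀ y z, P 0 y z) (zero_mid : ∀ x z, P x 0 z) (zero_right : ∀ x y, P x y 0)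
    (add_left : ∀ x x' y z, P x y z → P x' y z → P (x + x') y z)
    (add_mid : ∀ x y y' z, P x y z → P x y' z → P x (y + y') z)
    (add_right : ∀ x y z z', P x y z → P x y z' → P x y (z + z'))
    (tmul : ∀ a₁ a₂ b₁ b₂ c₁ c₂, P (a₁ ⊗ₜ a₂) (b₁ ⊗ₜ b₂) (c₁ ⊗ₜ c₂)) (x y z) : P x y z := by
  induction z with
  | zero => exact zero_right x y
  | add z z' hz hz' => exact add_right x y z z' hz hz'
  | tmul c₁ c₂ =>
    exact tensor_induction₂ (P := fun x y => P x y (c₁ ⊗ₜ c₂)) (fun _ => zero_left ..)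
      (fun _ => zero_mid ..) (fun _ _ _ => add_left _ _ _ _) (fun _ _ _ => add_mid _ _ _ _)
      (fun _ _ _ _ => tmul ..) x y

theorem SubstEq.tmul [Module ℂ L₁] [IsScalarTower ℂ (Polynomial ℂ) L₁]
    [Module ℂ L₂] [IsScalarTower ℂ (Polynomial ℂ) L₂]
    {T₁ : Module.End ℂ L₁} {T₂ : Module.End ℂ L₂}
    {T : Module.End ℂ (L₁ ⊗[Polynomial ℂ] L₂)}
    (hT₁ : ∀ x y, T₁ x ⊗ₜ[Polynomial ℂ] y = T (x ⊗ₜ y))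
    (hT₂ : ∀ x y, x ⊗ₜ[Polynomial ℂ] T₂ y = T (x ⊗ₜ y))
    {F : ℂ → L₁} {G : ℂ → L₂} {a : L₁} {b : L₂}
    (hF : SubstEq T₁ F a) (hG : SubstEq T₂ G b) :
    SubstEq T (fun v => F v ⊗ₜ[Polynomial ℂ] G v) (a ⊗ₜ b) := by
  let B : L₁ →ₗ[ℂ] L₂ →ₗ[ℂ] L₁ ⊗[Polynomial ℂ] L₂ :=
    LinearMap.mk₂ ℂ (fun x y => x ⊗ₜ y) (fun _ _ _ => add_tmul _ _ _)
      (fun _ _ _ => rfl) (fun _ _ _ => tmul_add _ _ _) (fun _ _ _ => tmul_smul _ _ _)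
  exact SubstEq.map (fun v => B.flip (G v)) (B.flip b) (fun x => hT₁ x b)
    (fun x => SubstEq.comp_linear (B x) (hT₂ x) hG) hF

end tensor

open TensorProduct in
/-- The tensor product (over `ℂ[∂]`) of two transposed Poisson
conformal algebras, equipped with the product
`(a₁⊗a₂)∘_λ(b₁⊗b₂) = (a₁∘¹_λ b₁)⊗(a₂∘²_λ b₂)` and the bracket
`[(a₁⊗a₂)_λ(b₁⊗b₂)] = [a₁_λ b₁]¹⊗(a₂∘²_λ b₂) + (a₁∘¹_λ b₁)⊗[a₂_λ b₂]²`,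
is a transposed Poisson conformal algebra.  Here the `ℂ[∂]`-module structures
are realised as genuine `Polynomial ℂ`-module structures, with `∂` acting as
multiplication by `X`; on each factor and on the tensor product, `D` denotes
the corresponding endomorphism. -/
theorem tpca_tensorProduct
    {L₁ : Type*} [AddCommGroup L₁] [Module ℂ L₁] [Module (Polynomial ℂ) L₁]
      [IsScalarTower ℂ (Polynomial ℂ) L₁]
    {L₂ : Type*} [AddCommGroup L₂] [Module ℂ L₂] [Module (Polynomial ℂ) L₂]
      [IsScalarTower ℂ (Polynomial ℂ) L₂]
    (m₁ br₁ : L₁ →ₗ[ℂ] L₁ →ₗ[ℂ] (ℕ →₀ L₁)) (m₂ br₂ : L₂ →ₗ[ℂ] L₂ →ₗ[ℂ] (ℕ →₀ L₂))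
    (D₁ : Module.End ℂ L₁) (hD₁ : ∀ x : L₁, D₁ x = (Polynomial.X : Polynomial ℂ) • x)
    (D₂ : Module.End ℂ L₂) (hD₂ : ∀ x : L₂, D₂ x = (Polynomial.X : Polynomial ℂ) • x)
    (h₁ : IsTPCA D₁ m₁ br₁) (h₂ : IsTPCA D₂ m₂ br₂)
    (D : Module.End ℂ (L₁ ⊗[Polynomial ℂ] L₂))
    (hD : ∀ w : L₁ ⊗[Polynomial ℂ] L₂, D w = (Polynomial.X : Polynomial ℂ) • w)
    (m br : (L₁ ⊗[Polynomial ℂ] L₂) →ₗ[ℂ] (L₁ ⊗[Polynomial ℂ] L₂) →ₗ[ℂ]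
      (ℕ →₀ (L₁ ⊗[Polynomial ℂ] L₂)))
    (hm : ∀ (a₁ b₁ : L₁) (a₂ b₂ : L₂) (l : ℂ),
      app m (sc l) (a₁ ⊗ₜ[Polynomial ℂ] a₂) (b₁ ⊗ₜ[Polynomial ℂ] b₂)
        = app m₁ (sc l) a₁ b₁ ⊗ₜ[Polynomial ℂ] app m₂ (sc l) a₂ b₂)
    (hbr : ∀ (a₁ b₁ : L₁) (a₂ b₂ : L₂) (l : ℂ),
      app br (sc l) (a₁ ⊗ₜ[Polynomial ℂ] a₂) (b₁ ⊗ₜ[Polynomial ℂ] b₂)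
        = app br₁ (sc l) a₁ b₁ ⊗ₜ[Polynomial ℂ] app m₂ (sc l) a₂ b₂
          + app m₁ (sc l) a₁ b₁ ⊗ₜ[Polynomial ℂ] app br₂ (sc l) a₂ b₂) :
    IsTPCA D m br := by
  have hDl : ∀ a b, D (a ⊗ₜ b) = D₁ a ⊗ₜ b := fun a b => by rw [hD, hD₁, smul_tmul']
  have hDr : ∀ a b, D (a ⊗ₜ b) = a ⊗ₜ D₂ b := fun a b => by rw [hD, hD₂, tmul_smul]
  have hsl : ∀ (l : ℂ) a b, (-(D₁ + sc l) : Module.End ℂ L₁) a ⊗ₜ[Polynomial ℂ] b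
      = (-(D + sc l) : Module.End ℂ (L₁ ⊗[Polynomial ℂ] L₂)) (a ⊗ₜ b) := fun l a b => by
    simp only [LinearMap.neg_apply, LinearMap.add_apply, sc_apply, hDl, neg_tmul, add_tmul,
      smul_tmul']
  have hsr : ∀ (l : ℂ) a b, a ⊗ₜ[Polynomial ℂ] (-(D₂ + sc l) : Module.End ℂ L₂) b
      = (-(D + sc l) : Module.End ℂ (L₁ ⊗[Polynomial ℂ] L₂)) (a ⊗ₜ b) := fun l a b => by
    simp only [LinearMap.neg_apply, LinearMap.add_apply, sc_apply, hDr, tmul_neg, tmul_add,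
      tmul_smul]
  have c₁ := h₁.commAssoc
  have c₂ := h₂.commAssoc
  refine ⟨⟨⟨fun x y l => ?_, fun x y l => ?_⟩, fun x y z l u => ?_, fun x y l => ?_⟩,
    ⟨fun x y l => ?_, fun x y l => ?_, fun x y z l u => ?_⟩, fun x y z l u => ?_⟩
  · induction x, y using tensor_induction₂ with
    | zero_left | zero_right => simp [app_zero_left, app_zero_right]
    | add_left _ _ _ h h' | add_right _ _ _ h h' =>
      simp only [map_add, app_add_left, app_add_right, smul_add, h, h']
    | tmul => rw [hDl, hm, hm, c₁.sesq_left, smul_tmul']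
  · induction x, y using tensor_induction₂ with
    | zero_left | zero_right => simp [app_zero_left, app_zero_right]
    | add_left _ _ _ h h' | add_right _ _ _ h h' =>
      simp only [map_add, app_add_left, app_add_right, smul_add, h, h']
      abel
    | tmul => rw [hDl, hm, hm, c₁.sesq_right, add_tmul, hDl, smul_tmul']
  · induction x, y, z using tensor_induction₃ with
    | zero_left | zero_mid | zero_right => simp [app_zero_left, app_zero_right]
    | add_left _ _ _ _ h h' | add_mid _ _ _ _ h h' | add_right _ _ _ _ h h' =>
      simp only [app_add_left, app_add_right, h, h']
    | tmul => rw [hm, hm, hm, hm, c₁.assoc, c₂.assoc]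
  · induction x, y using tensor_induction₂ with
    | zero_left | zero_right => simp [app_zero_left, app_zero_right]
    | add_left _ _ _ h h' | add_right _ _ _ h h' =>
      simp only [app_add_left, app_add_right, h, h']
    | tmul a₁ a₂ b₁ b₂ =>
      rw [hm, c₁.comm, c₂.comm]
      refine SubstEq.unique ?_ (SubstEq.app m _ _ _)
      simp only [hm]
      exact SubstEq.tmul (hsl l) (hsr l) (SubstEq.app ..) (SubstEq.app ..)
  · induction x, y using tensor_induction₂ with
    | zero_left | zero_right => simp [app_zero_left, app_zero_right]
    | add_left _ _ _ h h' | add_right _ _ _ h h' =>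
      simp only [map_add, app_add_left, app_add_right, smul_add, h, h']
    | tmul =>
      rw [hDl, hbr, hbr, c₁.sesq_left, h₁.lie.sesq_left, smul_add, smul_tmul', smul_tmul']
  · induction x, y using tensor_induction₂ with
    | zero_left | zero_right => simp [app_zero_left, app_zero_right]
    | add_left _ _ _ h h' | add_right _ _ _ h h' =>
      simp only [app_add_left, app_add_right, neg_add, h, h']
    | tmul a₁ a₂ b₁ b₂ =>
      rw [hbr, c₁.comm, c₂.comm, h₁.lie.skew, h₂.lie.skew, neg_tmul, tmul_neg, ← neg_add,
        add_comm (sc l) D₁, add_comm (sc l) D₂, add_comm (sc l) D, neg_inj]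
      refine SubstEq.unique ?_ (SubstEq.app br _ _ _)
      simp only [hbr]
      exact (SubstEq.tmul (hsl l) (hsr l) (SubstEq.app ..) (SubstEq.app ..)).add
        (SubstEq.tmul (hsl l) (hsr l) (SubstEq.app ..) (SubstEq.app ..))
  · induction x, y, z using tensor_induction₃ with
    | zero_left | zero_mid | zero_right => simp [app_zero_left, app_zero_right]
    | add_left _ _ _ _ h h' | add_mid _ _ _ _ h h' | add_right _ _ _ _ h h' =>
      simp only [app_add_left, app_add_right, h, h']
      abel
    | tmul a₁ a₂ b₁ b₂ d₁ d₂ =>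
      simp only [hbr, app_add_left, app_add_right]
      rw [h₁.lie.jacobi, h₂.lie.jacobi, ← c₁.assoc, ← c₂.assoc, c₁.left_comm b₁, c₂.left_comm b₂,
        h₁.app_bracket, h₂.app_bracket, h₁.app_bracket_swap, h₂.app_bracket_swap,
        h₁.bracket_app, h₂.bracket_app]
      simp only [tmul_add, add_tmul, tmul_sub, sub_tmul, tmul_smul, ← smul_tmul']
      module
  · induction x, y, z using tensor_induction₃ with
    | zero_left | zero_mid | zero_right => simp [app_zero_left, app_zero_right]
    | add_left _ _ _ _ h h' | add_mid _ _ _ _ h h' | add_right _ _ _ _ h h' =>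
      simp only [app_add_left, app_add_right, smul_add, h, h']
      abel
    | tmul a₁ a₂ b₁ b₂ d₁ d₂ =>
      simp only [hbr, hm, app_add_right, smul_add]
      rw [smul_tmul', ← tmul_smul, h₁.tLeibniz, h₂.tLeibniz, ← c₁.assoc, ← c₂.assoc,
        c₁.left_comm b₁, c₂.left_comm b₂]
      simp only [tmul_add, add_tmul]
      abel

end ConfFormal
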